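/- arXiv:2502.12609 — 2 statements merged into one kernel-verified Lean document; each statement's English description precedes it below -/
import Mathlib

section
/- Unisolvence of the Crouzeix–Raviart degrees of freedom for odd degree (Lemma 1.1 of the paper): let p be an odd positive integer and let v : ℝ² → ℝ be a polynomial of total degree at most p. Assume that (i) for every i ≠ j and every univariate polynomial q of degree at most p−1 one has ∫₀¹ v(γ_{ij}(t)) q(t) dt = 0, and (ii) for every polynomial m : ℝ² → ℝ of total degree at most p−3 one has ∫_K v·m dx = 0 with respect to two-dimensional Lebesgue measure (this condition is void when p < 3). Then v is the zero polynomial. -/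
open MeasureTheory Polynomial

/-- The edge parametrization `γ_{ij}(t) = A i + t • (A j - A i)`. -/
noncomputable def edgeParam (A : Fin 3 → (Fin 2 → ℝ)) (i j : Fin 3) (t : ℝ) :
    Fin 2 → ℝ :=
  A i + t • (A j - A i)

lemma CR_poly_zero (f : ℝ[X]) (hf : ∀ t ∈ Set.Icc (0:ℝ) 1, 0 ≤ f.eval t)
    (hi : ∫ t in (0:ℝ)..1, f.eval t = 0) : f = 0 := by
  apply Polynomial.eq_zero_of_infinite_isRoot
  apply (Set.Icc_infinite (zero_lt_one (α := ℝ))).mono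
  intro c hc
  by_contra hne
  have h0 : 0 < f.eval c := lt_of_le_of_ne (hf c hc) (fun h => hne h.symm)
  have := intervalIntegral.integral_pos (f := fun t => f.eval t) (zero_lt_one (α := ℝ))
    f.continuous.continuousOn (fun x hx => hf x ⟨hx.1.le, hx.2⟩) ⟨c, hc, h0⟩
  linarith

lemma CR_comp_deg (p : ℕ) (hp : Odd p) (g : ℝ[X]) (hg : g.natDegree ≤ p) :
    (g + g.comp (1 - X)).natDegree ≤ p - 1 := by
  have h1 : (1 - X : ℝ[X]).natDegree = 1 := by
    have : (1 - X : ℝ[X]) = C (-1) * X + C 1 := by simp; ring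
    rw [this]; exact natDegree_linear (by norm_num)
  have h1l : (1 - X : ℝ[X]).leadingCoeff = -1 := by
    have : (1 - X : ℝ[X]) = C (-1) * X + C 1 := by simp; ring
    rw [this]; exact leadingCoeff_linear (by norm_num)
  have hc : (g.comp (1 - X)).natDegree = g.natDegree := by rw [natDegree_comp, h1, mul_one]
  have hle : (g + g.comp (1 - X)).natDegree ≤ g.natDegree :=
    (natDegree_add_le _ _).trans (by simp [hc])
  rcases hg.lt_or_eq with h | h
  · omega
  · rw [natDegree_le_iff_coeff_eq_zero]
    intro N hN
    have hN' : p ≤ N := by omega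
    rcases hN'.lt_or_eq with h2 | h2
    · exact coeff_eq_zero_of_natDegree_lt (by omega)
    · have := coeff_comp_degree_mul_degree (p := g) (q := 1 - X) (by rw [h1]; norm_num)
      rw [h1, mul_one, h1l, h, hp.neg_one_pow] at this
      rw [← h2, coeff_add, this, leadingCoeff, h]; ring

lemma CR_edge_sym (p : ℕ) (hp : Odd p) (g : ℝ[X]) (hg : g.natDegree ≤ p)
    (ho : ∀ q : ℝ[X], q.natDegree ≤ p - 1 → ∫ t in (0:ℝ)..1, g.eval t * q.eval t = 0) :
    g.eval 0 + g.eval 1 = 0 := by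
  set h := g + g.comp (1 - X) with hh
  have hd : h.natDegree ≤ p - 1 := CR_comp_deg p hp g hg
  have hsym : ∀ t : ℝ, h.eval (1 - t) = h.eval t := by
    intro t; simp [hh, add_comm]
  have e1 := ho h hd
  have e2 : ∫ t in (0:ℝ)..1, g.eval (1 - t) * h.eval t = 0 := by
    have := intervalIntegral.integral_comp_sub_left (a := 0) (b := 1)
      (fun t => g.eval t * h.eval t) (1:ℝ)
    simp only [hsym, sub_self, sub_zero] at this
    rw [this, e1]
  have h0 : h * h = 0 := by
    apply CR_poly_zero
    · intro t _; rw [eval_mul]; exact mul_self_nonneg _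
    · have : ∀ t : ℝ, (h * h).eval t = g.eval t * h.eval t + g.eval (1 - t) * h.eval t := by
        intro t
        rw [eval_mul, ← add_mul]
        congr 1
        simp [hh]
      simp only [this]
      rw [intervalIntegral.integral_add, e1, e2, add_zero]
      · exact (Continuous.intervalIntegrable (by fun_prop) _ _)
      · exact (Continuous.intervalIntegrable (by fun_prop) _ _)
  have h0' : h = 0 := mul_self_eq_zero.mp h0
  have : h.eval 0 = 0 := by rw [h0']; simp
  simpa [hh] using this

lemma CR_edge_zero (p : ℕ) (g : ℝ[X]) (hg : g.natDegree ≤ p)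
    (ho : ∀ q : ℝ[X], q.natDegree ≤ p - 1 → ∫ t in (0:ℝ)..1, g.eval t * q.eval t = 0)
    (h0 : g.eval 0 = 0) : g = 0 := by
  obtain ⟨k, rfl⟩ : X ∣ g := by
    rw [X_dvd_iff, coeff_zero_eq_eval_zero, h0]
  by_cases hk : k = 0
  · simp [hk]
  have hd : k.natDegree ≤ p - 1 := by
    rw [natDegree_X_mul hk] at hg; omega
  have e := ho k hd
  have : X * k * k = 0 := by
    apply CR_poly_zero
    · intro t ht
      rw [mul_assoc, eval_mul, eval_mul, eval_X]
      exact mul_nonneg ht.1 (mul_self_nonneg _)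
    · simpa only [eval_mul] using e
  exact (mul_eq_zero.mp this).resolve_right hk

lemma CR_eval_bind (σ : Fin 2 → MvPolynomial (Fin 2) ℝ) (u : MvPolynomial (Fin 2) ℝ)
    (x : Fin 2 → ℝ) :
    MvPolynomial.eval x (MvPolynomial.bind₁ σ u)
      = MvPolynomial.eval (fun i => MvPolynomial.eval x (σ i)) u := by
  simp only [MvPolynomial.eval, MvPolynomial.eval₂Hom_bind₁]

lemma CR_dvd_sub_bind (L : MvPolynomial (Fin 2) ℝ) (d : Fin 2 → ℝ)
    (u : MvPolynomial (Fin 2) ℝ) :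
    L ∣ u - MvPolynomial.bind₁ (fun i => MvPolynomial.X i - MvPolynomial.C (d i) * L) u := by
  rw [← Ideal.mem_span_singleton, ← Ideal.Quotient.mk_eq_mk_iff_sub_mem]
  have : (Ideal.Quotient.mkₐ ℝ (Ideal.span {L})) =
    (Ideal.Quotient.mkₐ ℝ (Ideal.span {L})).comp
      (MvPolynomial.bind₁ (fun i => MvPolynomial.X i - MvPolynomial.C (d i) * L)) := by
    apply MvPolynomial.algHom_ext
    intro i
    rw [AlgHom.comp_apply, MvPolynomial.bind₁_X_right]
    simp only [Ideal.Quotient.mkₐ_eq_mk]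
    rw [Ideal.Quotient.mk_eq_mk_iff_sub_mem, Ideal.mem_span_singleton]
    exact ⟨MvPolynomial.C (d i), by ring⟩
  exact DFunLike.congr_fun this u

lemma CR_dvd_of_vanish (L : MvPolynomial (Fin 2) ℝ) (d : Fin 2 → ℝ)
    (hL : ∀ x, MvPolynomial.eval (x - MvPolynomial.eval x L • d) L = 0)
    (u : MvPolynomial (Fin 2) ℝ)
    (hu : ∀ x, MvPolynomial.eval x L = 0 → MvPolynomial.eval x u = 0) : L ∣ u := by
  have h := CR_dvd_sub_bind L d u
  have h0 : MvPolynomial.bind₁ (fun i => MvPolynomial.X i - MvPolynomial.C (d i) * L) u = 0 := by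
    apply MvPolynomial.funext
    intro x
    rw [CR_eval_bind, map_zero]
    have := hu _ (hL x)
    convert this using 3
    ext i
    simp [mul_comm]
  rwa [h0, sub_zero] at h

lemma CR_dvd_of_mul (L : MvPolynomial (Fin 2) ℝ) (d : Fin 2 → ℝ)
    (hL : ∀ x, MvPolynomial.eval (x - MvPolynomial.eval x L • d) L = 0)
    (u w : MvPolynomial (Fin 2) ℝ) (h : L ∣ u * w)
    (hx : ∃ x, MvPolynomial.eval x L = 0 ∧ MvPolynomial.eval x u ≠ 0) : L ∣ w := by
  obtain ⟨x, hx0, hxu⟩ := hx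
  set φ := MvPolynomial.bind₁ (R := ℝ)
    (fun i => MvPolynomial.X i - MvPolynomial.C (d i) * L) with hφ
  have hφe : ∀ (y : Fin 2 → ℝ) (f : MvPolynomial (Fin 2) ℝ), MvPolynomial.eval y (φ f) =
      MvPolynomial.eval (y - MvPolynomial.eval y L • d) f := by
    intro y f
    rw [hφ, CR_eval_bind]
    congr 2
    ext i
    simp [mul_comm]
  have hφL : φ L = 0 := by
    apply MvPolynomial.funext
    intro y
    rw [hφe, hL, map_zero]
  have h1 : φ u * φ w = 0 := by
    obtain ⟨k, hk⟩ := h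
    rw [← map_mul, hk, map_mul, hφL, zero_mul]
  have h2 : φ u ≠ 0 := by
    intro h0
    apply hxu
    have := hφe x u
    rw [h0, hx0] at this
    simpa using this.symm
  have h3 := (mul_eq_zero.mp h1).resolve_left h2
  have h4 := CR_dvd_sub_bind L d w
  rw [← hφ, h3, sub_zero] at h4
  exact h4

lemma CR_affine_poly (f : (Fin 2 → ℝ) →ᵃ[ℝ] ℝ) :
    ∃ L : MvPolynomial (Fin 2) ℝ, ∀ x, MvPolynomial.eval x L = f x := by
  refine ⟨MvPolynomial.C (f 0) + ∑ i, MvPolynomial.C (f.linear (Pi.single i 1)) *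
    MvPolynomial.X i, fun x => ?_⟩
  have h1 : f x = f.linear x + f 0 := by
    have := f.map_vadd 0 x
    simpa using this
  have h2 : f.linear x = ∑ i, x i * f.linear (Pi.single i 1) := by
    conv_lhs => rw [pi_eq_sum_univ' x]
    simp [Pi.single]
  rw [h1, h2]
  simp [mul_comm, add_comm]

lemma CR_bulk (K : Set (Fin 2 → ℝ)) (hK : IsCompact K) (hne : (interior K).Nonempty)
    (F : MvPolynomial (Fin 2) ℝ) (hF : ∀ x ∈ K, 0 ≤ MvPolynomial.eval x F)
    (hi : ∫ x in K, MvPolynomial.eval x F = 0) : F = 0 := by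
  have hc : Continuous (fun x => MvPolynomial.eval x F) := MvPolynomial.continuous_eval F
  have h1 := (setIntegral_eq_zero_iff_of_nonneg_ae
    ((ae_restrict_iff' hK.measurableSet).mpr (Filter.Eventually.of_forall hF))
    (hc.continuousOn.integrableOn_compact hK)).mp hi
  have h2 := ae_restrict_of_ae_restrict_of_subset interior_subset h1
  have h3 := Measure.eqOn_open_of_ae_eq h2 isOpen_interior hc.continuousOn continuousOn_const
  obtain ⟨x, hx⟩ := hne
  obtain ⟨ε, hε, hb⟩ := Metric.isOpen_iff.mp isOpen_interior x hx
  apply MvPolynomial.funext_set (fun i => Metric.ball (x i) ε)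
  · intro i
    rw [Real.ball_eq_Ioo]
    exact Set.Ioo_infinite (by linarith)
  · intro y hy
    rw [← ball_pi x hε] at hy
    simpa using h3 (hb hy)

/-- Unisolvence of the Crouzeix–Raviart degrees of freedom for odd degree `p`. -/
theorem CR_odd_unisolvence (p : ℕ) (hp_pos : 0 < p) (hp_odd : Odd p)
    (A : Fin 3 → (Fin 2 → ℝ)) (hA : AffineIndependent ℝ A)
    (v : MvPolynomial (Fin 2) ℝ) (hv : v.totalDegree ≤ p)
    (hedge : ∀ i j : Fin 3, i ≠ j → ∀ q : Polynomial ℝ, q.natDegree ≤ p - 1 →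
      ∫ t in (0:ℝ)..1,
        MvPolynomial.eval (edgeParam A i j t) v * q.eval t = 0)
    (hbulk : ∀ m : MvPolynomial (Fin 2) ℝ, (m.totalDegree : ℤ) ≤ (p : ℤ) - 3 →
      ∫ x in convexHull ℝ ({A 0, A 1, A 2} : Set (Fin 2 → ℝ)),
        MvPolynomial.eval x v * MvPolynomial.eval x m ∂volume = 0) :
    v = 0 := by
  -- edge polynomials
  have hpoly : ∀ i j : Fin 3, ∃ g : ℝ[X], g.natDegree ≤ p ∧
      ∀ t, g.eval t = MvPolynomial.eval (edgeParam A i j t) v := by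
    intro i j
    refine ⟨MvPolynomial.aeval (fun l => C (A j l - A i l) * X + C (A i l)) v, ?_, ?_⟩
    · have := MvPolynomial.aeval_natDegree_le (n := 1) v hv
        (fun l => C (A j l - A i l) * X + C (A i l)) (fun l => natDegree_linear_le)
      simpa using this
    · intro t
      rw [← Polynomial.coe_evalRingHom, MvPolynomial.aeval_def, MvPolynomial.hom_eval₂,
        MvPolynomial.eval, MvPolynomial.coe_eval₂Hom]
      congr 1
      · ext; simp
      · ext l; simp [edgeParam]; ring
  have hs : ∀ i j : Fin 3, i ≠ j →
      MvPolynomial.eval (A i) v + MvPolynomial.eval (A j) v = 0 := by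
    intro i j hij
    obtain ⟨g, hg, hge⟩ := hpoly i j
    have := CR_edge_sym p hp_odd g hg (fun q hq => by simpa only [hge] using hedge i j hij q hq)
    rw [hge, hge] at this
    simpa [edgeParam] using this
  have hvert : ∀ i, MvPolynomial.eval (A i) v = 0 := by
    have h1 := hs 0 1 (by decide)
    have h2 := hs 1 2 (by decide)
    have h3 := hs 0 2 (by decide)
    intro i
    fin_cases i <;> simp <;> linarith
  have hed : ∀ i j : Fin 3, i ≠ j → ∀ t, MvPolynomial.eval (edgeParam A i j t) v = 0 := by
    intro i j hij t
    obtain ⟨g, hg, hge⟩ := hpoly i j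
    have := CR_edge_zero p g hg (fun q hq => by simpa only [hge] using hedge i j hij q hq)
      (by rw [hge]; simpa [edgeParam] using hvert i)
    rw [← hge, this, eval_zero]
  -- barycentric coordinates
  have htop : affineSpan ℝ (Set.range A) = ⊤ := by
    rw [hA.affineSpan_eq_top_iff_card_eq_finrank_add_one]; simp
  let b : AffineBasis (Fin 3) ℝ (Fin 2 → ℝ) := ⟨A, hA, htop⟩
  have hbA : ∀ i, b i = A i := fun _ => rfl
  choose L hL using fun i => CR_affine_poly (b.coord i)
  have hLA : ∀ i j, MvPolynomial.eval (A j) (L i) = if i = j then 1 else 0 := by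
    intro i j
    rw [hL, ← hbA, b.coord_apply]
  have hproj : ∀ i, ∀ x, MvPolynomial.eval
      (x - MvPolynomial.eval x (L i) • (A i - A (i + 1))) (L i) = 0 := by
    intro i x
    have hne : i ≠ i + 1 := by fin_cases i <;> decide
    have h1 : (b.coord i).linear (A i - A (i + 1)) = 1 := by
      have := (b.coord i).linearMap_vsub (A i) (A (i + 1))
      rw [← hL, ← hL, hLA, hLA, if_pos rfl, if_neg hne] at this
      simpa using this
    have h2 := (b.coord i).map_vadd x (-((b.coord i x) • (A i - A (i + 1))))
    rw [hL, hL, sub_eq_neg_add]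
    rw [map_neg, map_smul, h1] at h2
    simpa using h2
  have hline : ∀ i x, MvPolynomial.eval x (L i) = 0 → MvPolynomial.eval x v = 0 := by
    intro i x hx
    have h1 := b.linear_combination_coord_eq_self x
    have h2 := b.sum_coord_apply_eq_one x
    rw [Fin.sum_univ_three] at h1 h2
    rw [hL] at hx
    simp only [hbA] at h1
    have key : ∀ j k : Fin 3, j ≠ k → b.coord j x + b.coord k x = 1 →
        b.coord j x • A j + b.coord k x • A k = x → MvPolynomial.eval x v = 0 := by
      intro j k hjk e1 e2
      have := hed j k hjk (b.coord k x)
      have e3 : edgeParam A j k (b.coord k x) = x := by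
        rw [← eq_sub_iff_add_eq] at e1
        rw [e1] at e2
        conv_rhs => rw [← e2]
        unfold edgeParam
        module
      rwa [e3] at this
    fin_cases i
    · have hx : b.coord 0 x = 0 := hx
      rw [hx] at h1 h2
      exact key 1 2 (by decide) (by simpa using h2) (by simpa using h1)
    · have hx : b.coord 1 x = 0 := hx
      rw [hx] at h1 h2
      exact key 0 2 (by decide) (by simpa using h2) (by simpa using h1)
    · have hx : b.coord 2 x = 0 := hx
      rw [hx] at h1 h2
      exact key 0 1 (by decide) (by simpa using h2) (by simpa using h1)
  have hdv : ∀ i, L i ∣ v := fun i => CR_dvd_of_vanish (L i) _ (hproj i) v (hline i)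
  obtain ⟨v1, rfl⟩ := hdv 0
  obtain ⟨v2, rfl⟩ := CR_dvd_of_mul (L 1) _ (hproj 1) _ _ (hdv 1) ⟨A 0, by simp [hLA]⟩
  have h3 : L 2 ∣ L 1 * v2 := CR_dvd_of_mul (L 2) _ (hproj 2) _ _ (hdv 2) ⟨A 0, by simp [hLA]⟩
  obtain ⟨w, rfl⟩ := CR_dvd_of_mul (L 2) _ (hproj 2) _ _ h3 ⟨A 1, by simp [hLA]⟩
  by_cases hw : w = 0
  · simp [hw]
  have hL0 : ∀ i, L i ≠ 0 := by
    intro i h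
    have := hLA i i
    rw [h] at this
    simp at this
  have hLd : ∀ i, 1 ≤ (L i).totalDegree := by
    intro i
    by_contra h
    have h0 : (L i).totalDegree = 0 := by omega
    rw [MvPolynomial.totalDegree_eq_zero_iff_eq_C] at h0
    have hne : i ≠ i + 1 := by fin_cases i <;> decide
    have e1 := hLA i i
    have e2 := hLA i (i + 1)
    rw [h0, MvPolynomial.eval_C, if_pos rfl] at e1
    rw [h0, MvPolynomial.eval_C, if_neg hne] at e2
    linarith
  have hdeg : (w.totalDegree : ℤ) ≤ (p : ℤ) - 3 := by
    rw [MvPolynomial.totalDegree_mul_of_isDomain (hL0 0) (by simp [hL0, hw]),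
      MvPolynomial.totalDegree_mul_of_isDomain (hL0 1) (by simp [hL0, hw]),
      MvPolynomial.totalDegree_mul_of_isDomain (hL0 2) hw] at hv
    have := hLd 0
    have := hLd 1
    have := hLd 2
    omega
  have hset : ({A 0, A 1, A 2} : Set (Fin 2 → ℝ)) = Set.range b := by
    ext x
    simp only [Set.mem_insert_iff, Set.mem_singleton_iff, Set.mem_range, hbA, Fin.exists_fin_succ,
      eq_comm (a := x)]
    simp
  have hfin := hbulk w hdeg
  rw [hset] at hfin
  have hz := CR_bulk (convexHull ℝ (Set.range b)) ((Set.finite_range b).isCompact_convexHull (𝕜 := ℝ))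
    (interior_convexHull_nonempty_iff_affineSpan_eq_top.mpr htop)
    (L 0 * (L 1 * (L 2 * w)) * w) (by
      intro x hx
      rw [b.convexHull_eq_nonneg_coord] at hx
      simp only [map_mul, hL]
      have e0 := hx 0
      have e1 := hx 1
      have e2 := hx 2
      have e3 := mul_self_nonneg (MvPolynomial.eval x w)
      have : b.coord 0 x * (b.coord 1 x * (b.coord 2 x * MvPolynomial.eval x w)) *
        MvPolynomial.eval x w = b.coord 0 x * (b.coord 1 x * (b.coord 2 x *
          (MvPolynomial.eval x w * MvPolynomial.eval x w))) := by ring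
      rw [this]
      exact mul_nonneg e0 (mul_nonneg e1 (mul_nonneg e2 e3)))
    (by rw [← hfin]; simp only [map_mul])
  exact (mul_eq_zero.mp hz).resolve_right hw
end

section
/- Unisolvence of the new even-degree Crouzeix–Raviart degrees of freedom (Lemma 2.1 of the paper): let p be an even positive integer and let v : ℝ² → ℝ be a polynomial of total degree at most p. Assume that (i) for every i ≠ j and every index k ∈ {0, 1, …, p−2} ∪ {p} one has ∫₀¹ v(γ_{ij}(t)) L_k(2t−1) dt = 0, and (ii) for every polynomial m : ℝ² → ℝ of total degree at most p−3 one has ∫_K v·m dx = 0 with respect to two-dimensional Lebesgue measure (this condition is void when p < 3). Then v is the zero polynomial. -/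
open MeasureTheory Polynomial

/-- The Legendre polynomial of degree `k`, via Rodrigues' formula
`L_k(x) = (1/(2^k k!)) (d/dx)^k [(x² − 1)^k]`. -/
noncomputable def legendre (k : ℕ) : Polynomial ℝ :=
  ((2 ^ k * k.factorial : ℝ)⁻¹) •
    ((fun q : Polynomial ℝ => Polynomial.derivative q)^[k] ((Polynomial.X ^ 2 - 1) ^ k))

theorem iter_deriv_comp_neg (f : ℝ[X]) (k : ℕ) :
    (derivative^[k] (f.comp (-X))) = (-1) ^ k * (derivative^[k] f).comp (-X) := by
  induction k with
  | zero => simp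
  | succ k ih =>
    rw [Function.iterate_succ_apply', ih, Function.iterate_succ_apply']
    have h : derivative ((-1 : ℝ[X]) ^ k) = 0 := by
      have : (-1 : ℝ[X]) ^ k = C ((-1) ^ k) := by simp
      rw [this, derivative_C]
    rw [derivative_mul, h, derivative_comp]
    simp
    ring

theorem legendre_eval_neg (k : ℕ) (x : ℝ) :
    (legendre k).eval (-x) = (-1) ^ k * (legendre k).eval x := by
  have h := iter_deriv_comp_neg ((X ^ 2 - 1) ^ k) k
  have h0 : ((X ^ 2 - 1 : ℝ[X]) ^ k).comp (-X) = (X ^ 2 - 1) ^ k := by simp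
  rw [h0] at h
  have h1 := congrArg (Polynomial.eval x) h
  have h2 : (-1 : ℝ) ^ k * (-1) ^ k = 1 := by rw [← mul_pow]; simp
  simp only [eval_mul, eval_pow, eval_neg, eval_one, eval_comp, eval_X] at h1
  change eval (-x) ((2 ^ k * k.factorial : ℝ)⁻¹ • (derivative^[k] ((X ^ 2 - 1) ^ k)))
    = (-1) ^ k * eval x ((2 ^ k * k.factorial : ℝ)⁻¹ • (derivative^[k] ((X ^ 2 - 1) ^ k)))
  rw [eval_smul, eval_smul, h1, smul_eq_mul, smul_eq_mul]
  linear_combination (-(2 ^ k * k.factorial : ℝ)⁻¹ * eval (-x) (derivative^[k] ((X ^ 2 - 1) ^ k))) * h2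

theorem legendre_natDegree (k : ℕ) : (legendre k).natDegree = k ∧ legendre k ≠ 0 := by
  have hm : ((X ^ 2 - 1 : ℝ[X]) ^ k).Monic := by
    have : (X ^ 2 - 1 : ℝ[X]).Monic := by
      have := monic_X_pow_sub_C (1 : ℝ) (n := 2) (by norm_num)
      simpa using this
    exact this.pow k
  have hd : ((X ^ 2 - 1 : ℝ[X]) ^ k).natDegree = 2 * k := by
    have : (X ^ 2 - 1 : ℝ[X]).natDegree = 2 := by
      have := natDegree_X_pow_sub_C (n := 2) (r := (1 : ℝ))
      simpa using this
    rw [natDegree_pow, this, mul_comm]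
  have hc : (legendre k).coeff k ≠ 0 := by
    change ((2 ^ k * k.factorial : ℝ)⁻¹ • (derivative^[k] ((X ^ 2 - 1 : ℝ[X]) ^ k))).coeff k ≠ 0
    have hl : ((X ^ 2 - 1 : ℝ[X]) ^ k).coeff (k + k) = 1 := by
      have := hm.coeff_natDegree
      rw [hd, two_mul] at this
      exact this
    rw [coeff_smul, coeff_iterate_derivative, hl]
    have : (k + k).descFactorial k ≠ 0 := by
      rw [Ne, Nat.descFactorial_eq_zero_iff_lt]; omega
    have : ((k + k).descFactorial k : ℝ) ≠ 0 := by exact_mod_cast this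
    have h3 : (k.factorial : ℝ) ≠ 0 := by exact_mod_cast k.factorial_ne_zero
    simp [this, h3]
  have hle : (legendre k).natDegree ≤ k := by
    change ((2 ^ k * k.factorial : ℝ)⁻¹ • (derivative^[k] ((X ^ 2 - 1 : ℝ[X]) ^ k))).natDegree ≤ k
    refine (natDegree_smul_le _ _).trans ?_
    refine (natDegree_iterate_derivative _ _).trans ?_
    rw [hd]; omega
  refine ⟨le_antisymm hle (le_natDegree_of_ne_zero hc), ?_⟩
  rintro h
  simp [h] at hc

/-- The shifted Legendre polynomials as a polynomial sequence. -/
noncomputable def shiftSeq : Polynomial.Sequence ℝ where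
  elems' k := (legendre k).comp (C 2 * X + C (-1))
  degree_eq' k := by
    have h1 : (C 2 * X + C (-1) : ℝ[X]).natDegree = 1 := natDegree_linear (by norm_num)
    have h2 : ((legendre k).comp (C 2 * X + C (-1))).natDegree = k := by
      rw [natDegree_comp, h1, (legendre_natDegree k).1, mul_one]
    rcases Nat.eq_zero_or_pos k with rfl | hk
    · have : legendre 0 = 1 := by simp [legendre]
      simp [this]
    · rw [degree_eq_iff_natDegree_eq_of_pos hk, h2]

theorem shiftSeq_eval (k : ℕ) (t : ℝ) : (shiftSeq k).eval t = (legendre k).eval (2 * t - 1) := by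
  change ((legendre k).comp (C 2 * X + C (-1))).eval t = _
  simp [eval_comp, sub_eq_add_neg]

theorem intg (q r : ℝ[X]) : IntervalIntegrable (fun t => q.eval t * r.eval t) volume 0 1 :=
  (q.continuous.mul r.continuous).intervalIntegrable _ _

theorem orth_all (q : ℝ[X]) (n : ℕ)
    (h : ∀ k ≤ n, ∫ t in (0:ℝ)..1, q.eval t * (legendre k).eval (2 * t - 1) = 0)
    (r : ℝ[X]) (hr : r.natDegree ≤ n) : ∫ t in (0:ℝ)..1, q.eval t * r.eval t = 0 := by
  have hs := shiftSeq.span_degreeLE (m := n) (fun i _ => by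
    rw [isUnit_iff_ne_zero, leadingCoeff_ne_zero]
    exact shiftSeq.ne_zero i)
  have hm : r ∈ degreeLE ℝ (n : WithBot ℕ) := by
    rw [mem_degreeLE]; exact natDegree_le_iff_degree_le.1 hr
  rw [← hs] at hm
  clear hr
  induction hm using Submodule.span_induction with
  | mem x hx =>
    obtain ⟨k, hk, rfl⟩ := hx
    simp only [shiftSeq_eval]
    exact h k hk
  | zero => simp
  | add x y _ _ hx hy =>
    have h1 := intervalIntegral.integral_add (intg q x) (intg q y)
    simp only [eval_add, mul_add]
    exact h1.trans (by rw [hx, hy, add_zero])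
  | smul a x _ hx =>
    have h1 := intervalIntegral.integral_const_mul (μ := volume) (a := 0) (b := 1) a
      (fun t => q.eval t * x.eval t)
    rw [hx, mul_zero] at h1
    rw [← h1]
    congr 1; ext t
    simp only [eval_smul, smul_eq_mul]
    ring

theorem pos_zero (w r : ℝ[X]) (hw : ∀ t ∈ Set.Ioo (0:ℝ) 1, 0 < w.eval t)
    (h : ∫ t in (0:ℝ)..1, (w * r).eval t * r.eval t = 0) : r = 0 := by
  by_contra hr
  have hex : ∃ c ∈ Set.Ioo (0:ℝ) 1, r.eval c ≠ 0 := by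
    by_contra! hcon
    exact hr (eq_zero_of_infinite_isRoot r ((Set.Ioo_infinite (by norm_num : (0:ℝ) < 1)).mono
      (fun x hx => hcon x hx)))
  obtain ⟨c, hc, hrc⟩ := hex
  have hwc : ∀ t ∈ Set.Icc (0:ℝ) 1, 0 ≤ w.eval t := by
    intro t ht
    have : closure (Set.Ioo (0:ℝ) 1) ⊆ {t | 0 ≤ w.eval t} :=
      closure_minimal (fun x hx => (hw x hx).le) (isClosed_le continuous_const w.continuous)
    rw [closure_Ioo (by norm_num)] at this
    exact this ht
  have := intervalIntegral.integral_pos (f := fun t => (w * r).eval t * r.eval t)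
    (by norm_num : (0:ℝ) < 1) ((w * r).continuous.mul r.continuous).continuousOn
    (fun x hx => by
      have := hwc x ⟨hx.1.le, hx.2⟩
      simp only [eval_mul]; rw [mul_assoc]; exact mul_nonneg this (mul_self_nonneg _))
    ⟨c, ⟨hc.1.le, hc.2.le⟩, by
      simp only [eval_mul]; rw [mul_assoc]; exact mul_pos (hw c hc) (mul_self_pos.2 hrc)⟩
  linarith

/-- antisymmetry of the trace -/
theorem edge_antisymm (p : ℕ) (hp : Even p) (hp0 : 0 < p) (q : ℝ[X]) (hq : q.natDegree ≤ p)
    (h : ∀ k, (k ≤ p - 2 ∨ k = p) →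
      ∫ t in (0:ℝ)..1, q.eval t * (legendre k).eval (2 * t - 1) = 0) :
    q.eval 1 = - q.eval 0 := by
  have hflip : ∀ k, ∫ t in (0:ℝ)..1, q.eval (1 - t) * (legendre k).eval (2 * t - 1) =
      (-1) ^ k * ∫ t in (0:ℝ)..1, q.eval t * (legendre k).eval (2 * t - 1) := by
    intro k
    have := intervalIntegral.integral_comp_sub_left (a := 0) (b := 1)
      (fun t => q.eval t * (legendre k).eval (1 - 2 * t)) (1:ℝ)
    simp only [sub_zero, sub_self] at this
    rw [← intervalIntegral.integral_const_mul]
    calc _ = ∫ x in (0:ℝ)..1, eval (1 - x) q * eval (1 - 2 * (1 - x)) (legendre k) := by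
          congr 1; ext t; congr 2; ring
      _ = _ := this
      _ = _ := by
          congr 1; ext t
          rw [show 1 - 2 * t = -(2 * t - 1) by ring, legendre_eval_neg]; ring
  set e : ℝ[X] := q + q.comp (C (-1) * X + C 1) with he
  have hee : ∀ t, e.eval t = q.eval t + q.eval (1 - t) := by
    intro t; simp only [he, eval_add, eval_comp, eval_mul, eval_C, eval_X]; ring_nf
  have hed : e.natDegree ≤ p := by
    refine natDegree_add_le_of_degree_le hq (natDegree_comp_le.trans ?_)
    have : (C (-1) * X + C 1 : ℝ[X]).natDegree ≤ 1 := natDegree_linear_le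
    calc _ ≤ q.natDegree * 1 := Nat.mul_le_mul_left _ this
      _ ≤ p := by omega
  have hek : ∀ k ≤ p, ∫ t in (0:ℝ)..1, e.eval t * (legendre k).eval (2 * t - 1) = 0 := by
    intro k hk
    have h1 : ∫ t in (0:ℝ)..1, e.eval t * (legendre k).eval (2 * t - 1) =
        (1 + (-1) ^ k) * ∫ t in (0:ℝ)..1, q.eval t * (legendre k).eval (2 * t - 1) := by
      rw [add_mul, ← hflip, one_mul, ← intervalIntegral.integral_add]
      · congr 1; ext t; rw [hee]; ring
      · exact (by fun_prop : Continuous _).intervalIntegrable _ _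
      · exact (by fun_prop : Continuous _).intervalIntegrable _ _
    rw [h1]
    by_cases hk' : k ≤ p - 2 ∨ k = p
    · rw [h k hk', mul_zero]
    · have : Odd k := by
        rcases hp with ⟨m, hm⟩
        exact ⟨m - 1, by omega⟩
      rw [this.neg_one_pow]; simp
  have h0 := orth_all e p hek e hed
  have h1 : e = 0 := pos_zero 1 e (by simp) (by simpa using h0)
  have h2 := hee 0
  rw [h1] at h2
  simp at h2
  linarith

theorem edge_zero (p : ℕ) (hp : 2 ≤ p) (q : ℝ[X]) (hq : q.natDegree ≤ p)
    (h : ∀ k, k ≤ p - 2 →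
      ∫ t in (0:ℝ)..1, q.eval t * (legendre k).eval (2 * t - 1) = 0)
    (h0 : q.eval 0 = 0) (h1 : q.eval 1 = 0) : q = 0 := by
  obtain ⟨a, rfl⟩ := dvd_iff_isRoot.2 h0
  have ha : a.eval 1 = 0 := by simpa using h1
  obtain ⟨b, rfl⟩ := dvd_iff_isRoot.2 ha
  by_contra hne
  have hb : b ≠ 0 := by rintro rfl; simp at hne
  have hbd : b.natDegree + 2 ≤ p := by
    rw [natDegree_mul (X_sub_C_ne_zero _) (mul_ne_zero (X_sub_C_ne_zero _) hb),
      natDegree_mul (X_sub_C_ne_zero _) hb, natDegree_X_sub_C, natDegree_X_sub_C] at hq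
    omega
  have := orth_all _ (p - 2) h b (by omega)
  apply hb
  apply pos_zero (-((X - C 0) * (X - C 1))) b
  · intro t ht
    simp
    nlinarith [ht.1, ht.2]
  · have h5 : ∀ t : ℝ, eval t (-((X - C 0) * (X - C 1)) * b) * eval t b
      = - (eval t ((X - C 0) * ((X - C 1) * b)) * eval t b) := by
      intro t; simp only [eval_mul, eval_neg]; ring
    simp only [h5, intervalIntegral.integral_neg, this, neg_zero]


/-- restriction of a bivariate polynomial to the line through `P`, `Q` -/
noncomputable def restr (P Q : Fin 2 → ℝ) : MvPolynomial (Fin 2) ℝ →ₐ[ℝ] ℝ[X] :=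
  MvPolynomial.aeval (fun m => C (Q m - P m) * X + C (P m))

theorem restr_eval (P Q : Fin 2 → ℝ) (f : MvPolynomial (Fin 2) ℝ) (t : ℝ) :
    (restr P Q f).eval t = MvPolynomial.eval (P + t • (Q - P)) f := by
  induction f using MvPolynomial.induction_on with
  | C a => simp [restr]
  | add f g hf hg => simp only [map_add, eval_add, hf, hg]
  | mul_X f m hf =>
    simp only [map_mul, eval_mul, hf, MvPolynomial.eval_X]
    simp [restr]
    left; ring

theorem restr_natDegree (P Q : Fin 2 → ℝ) (f : MvPolynomial (Fin 2) ℝ) (n : ℕ)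
    (h : f.totalDegree ≤ n) : (restr P Q f).natDegree ≤ n := by
  have := MvPolynomial.aeval_natDegree_le f h (fun m => C (Q m - P m) * X + C (P m)) (n := 1)
    (fun i => natDegree_linear_le)
  simpa [restr] using this

/-- linear form vanishing on the line through `P`, `Q` -/
noncomputable def lin (P Q : Fin 2 → ℝ) : MvPolynomial (Fin 2) ℝ :=
  MvPolynomial.C (Q 0 - P 0) * (MvPolynomial.X 1 - MvPolynomial.C (P 1)) -
    MvPolynomial.C (Q 1 - P 1) * (MvPolynomial.X 0 - MvPolynomial.C (P 0))

theorem lin_eval (P Q x : Fin 2 → ℝ) : MvPolynomial.eval x (lin P Q) =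
    (Q 0 - P 0) * (x 1 - P 1) - (Q 1 - P 1) * (x 0 - P 0) := by
  simp [lin]

theorem lin_dvd (P Q : Fin 2 → ℝ) (hPQ : (Q 0 - P 0) ^ 2 + (Q 1 - P 1) ^ 2 ≠ 0)
    (f : MvPolynomial (Fin 2) ℝ) (h : restr P Q f = 0) : lin P Q ∣ f := by
  set N := (Q 0 - P 0) ^ 2 + (Q 1 - P 1) ^ 2 with hN
  set τ : MvPolynomial (Fin 2) ℝ := MvPolynomial.C N⁻¹ *
    (MvPolynomial.C (Q 0 - P 0) * (MvPolynomial.X 0 - MvPolynomial.C (P 0)) +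
      MvPolynomial.C (Q 1 - P 1) * (MvPolynomial.X 1 - MvPolynomial.C (P 1))) with hτ
  have key : ∀ g : MvPolynomial (Fin 2) ℝ,
      lin P Q ∣ g - Polynomial.aeval τ (restr P Q g) := by
    intro g
    induction g using MvPolynomial.induction_on with
    | C a => simp [restr, MvPolynomial.algebraMap_eq]
    | add f g hf hg =>
      rw [map_add, map_add, add_sub_add_comm]
      exact dvd_add hf hg
    | mul_X f m hf =>
      have hX : lin P Q ∣ (MvPolynomial.X m : MvPolynomial (Fin 2) ℝ) -
          Polynomial.aeval τ (restr P Q (MvPolynomial.X m)) := by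
        have hCN : (MvPolynomial.C N⁻¹ : MvPolynomial (Fin 2) ℝ) *
          ((MvPolynomial.C (Q 0) - MvPolynomial.C (P 0)) ^ 2 +
            (MvPolynomial.C (Q 1) - MvPolynomial.C (P 1)) ^ 2) = 1 := by
          simp only [← MvPolynomial.C_sub, ← MvPolynomial.C_pow, ← MvPolynomial.C_add,
            ← MvPolynomial.C_mul]
          rw [← hN, inv_mul_cancel₀ hPQ, MvPolynomial.C_1]
        fin_cases m
        · refine ⟨MvPolynomial.C (-(Q 1 - P 1) * N⁻¹), ?_⟩
          simp [restr, hτ, lin, MvPolynomial.algebraMap_eq]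
          linear_combination (-(MvPolynomial.X 0 - MvPolynomial.C (P 0))) * hCN
        · refine ⟨MvPolynomial.C ((Q 0 - P 0) * N⁻¹), ?_⟩
          simp [restr, hτ, lin, MvPolynomial.algebraMap_eq]
          linear_combination (-(MvPolynomial.X 1 - MvPolynomial.C (P 1))) * hCN
      rw [map_mul, map_mul]
      obtain ⟨a, ha⟩ := hf
      obtain ⟨b, hb⟩ := hX
      refine ⟨a * MvPolynomial.X m + Polynomial.aeval τ (restr P Q f) * b, ?_⟩
      linear_combination (MvPolynomial.X m) * ha + (Polynomial.aeval τ (restr P Q f)) * hb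
  have := key f
  rwa [h, map_zero, sub_zero] at this

/-- signed double area -/
def area (P Q R : Fin 2 → ℝ) : ℝ := (Q 0 - P 0) * (R 1 - P 1) - (Q 1 - P 1) * (R 0 - P 0)

theorem area_ne (A : Fin 3 → (Fin 2 → ℝ)) (hA : AffineIndependent ℝ A) :
    area (A 0) (A 1) (A 2) ≠ 0 := by
  intro h
  have h2 := (affineIndependent_iff (k := ℝ)).1 hA Finset.univ
  have hne01 : A 1 ≠ A 0 := fun h => by simpa using hA.injective h
  have hz : ∀ m, A 1 m - A 0 m = 0 := by
    intro m
    have := h2 ![(A 2 m - A 0 m) - (A 1 m - A 0 m), -(A 2 m - A 0 m), (A 1 m - A 0 m)]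
      (by simp [Fin.sum_univ_three])
      (by
        ext l
        unfold area at h
        fin_cases m <;> fin_cases l <;> simp [Fin.sum_univ_three] <;> linarith)
      2 (Finset.mem_univ _)
    simpa using this
  exact hne01 (funext fun m => by linarith [hz m])

theorem lin_degree (P Q R : Fin 2 → ℝ) (h : area P Q R ≠ 0) :
    lin P Q ≠ 0 ∧ 1 ≤ (lin P Q).totalDegree := by
  have h1 : MvPolynomial.eval R (lin P Q) ≠ 0 := by rw [lin_eval]; exact h
  refine ⟨fun h0 => h1 (by simp [h0]), ?_⟩
  by_contra hlt
  have h0 : (lin P Q).totalDegree = 0 := by omega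
  rw [MvPolynomial.totalDegree_eq_zero_iff_eq_C] at h0
  have hP : MvPolynomial.eval P (lin P Q) = 0 := by rw [lin_eval]; ring
  rw [h0, MvPolynomial.eval_C] at hP h1
  exact h1 hP

theorem area_pos (P Q R : Fin 2 → ℝ) (h : area P Q R ≠ 0) :
    (Q 0 - P 0) ^ 2 + (Q 1 - P 1) ^ 2 ≠ 0 := by
  intro h0
  have h1 : Q 0 - P 0 = 0 := by nlinarith [sq_nonneg (Q 0 - P 0), sq_nonneg (Q 1 - P 1)]
  have h2 : Q 1 - P 1 = 0 := by nlinarith [sq_nonneg (Q 0 - P 0), sq_nonneg (Q 1 - P 1)]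
  exact h (by simp [area, h1, h2])

/-- bubble factorisation -/
theorem factor (P Q R : Fin 2 → ℝ) (h : area P Q R ≠ 0) (v : MvPolynomial (Fin 2) ℝ)
    (h1 : restr P Q v = 0) (h2 : restr Q R v = 0) (h3 : restr R P v = 0) :
    ∃ w, v = lin P Q * (lin Q R * (lin R P * w)) := by
  have hQ : area Q R P ≠ 0 := by
    have : area Q R P = area P Q R := by unfold area; ring
    rwa [this]
  have hR : area R P Q ≠ 0 := by
    have : area R P Q = area P Q R := by unfold area; ring
    rwa [this]
  have hn : ∀ P Q S T : Fin 2 → ℝ, area P Q T ≠ 0 → restr S T (lin P Q) ≠ 0 := by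
    intro P Q S T hT h0
    have := restr_eval S T (lin P Q) 1
    rw [h0, lin_eval] at this
    apply hT
    simp at this
    unfold area
    linarith
  have hn' : ∀ P Q S T : Fin 2 → ℝ, area P Q S ≠ 0 → restr S T (lin P Q) ≠ 0 := by
    intro P Q S T hT h0
    have := restr_eval S T (lin P Q) 0
    rw [h0, lin_eval] at this
    apply hT
    simp at this
    unfold area
    linarith
  obtain ⟨a, rfl⟩ := lin_dvd P Q (area_pos P Q R h) v h1
  have h2a : restr Q R a = 0 := by
    rw [map_mul] at h2
    exact (mul_eq_zero.1 h2).resolve_left (hn P Q Q R h)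
  obtain ⟨b, rfl⟩ := lin_dvd Q R (area_pos Q R P hQ) a h2a
  have h3b : restr R P b = 0 := by
    rw [map_mul, map_mul] at h3
    exact (mul_eq_zero.1 ((mul_eq_zero.1 h3).resolve_left (hn' P Q R P h))).resolve_left
      (hn Q R R P hQ)
  obtain ⟨c, rfl⟩ := lin_dvd R P (area_pos R P Q hR) b h3b
  exact ⟨c, rfl⟩

theorem bubble_nonneg (P Q R x : Fin 2 → ℝ) (hx : x ∈ convexHull ℝ ({P, Q, R} : Set (Fin 2 → ℝ))) :
    0 ≤ area P Q R * (MvPolynomial.eval x (lin P Q) *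
      (MvPolynomial.eval x (lin Q R) * MvPolynomial.eval x (lin R P))) := by
  have hx' : ∃ a b c : ℝ, 0 ≤ a ∧ 0 ≤ b ∧ 0 ≤ c ∧ a + b + c = 1 ∧ a • P + b • Q + c • R = x := by
    have hsub : convexHull ℝ ({P, Q, R} : Set (Fin 2 → ℝ)) ⊆
      {x | ∃ a b c : ℝ, 0 ≤ a ∧ 0 ≤ b ∧ 0 ≤ c ∧ a + b + c = 1 ∧ a • P + b • Q + c • R = x} := by
      apply convexHull_min
      · rintro y (rfl | rfl | rfl)
        · exact ⟨1, 0, 0, by simp⟩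
        · exact ⟨0, 1, 0, by simp⟩
        · exact ⟨0, 0, 1, by simp⟩
      · rintro y ⟨a, b, c, ha, hb, hc, h1, rfl⟩ z ⟨a', b', c', ha', hb', hc', h1', rfl⟩ s t hs ht hst
        refine ⟨s * a + t * a', s * b + t * b', s * c + t * c', by positivity, by positivity,
          by positivity, ?_, by module⟩
        linear_combination s * h1 + t * h1' + hst
    exact hsub hx
  obtain ⟨a, b, c, ha, hb, hc, h1, rfl⟩ := hx'
  have ha1 : a = 1 - b - c := by linarith
  have : area P Q R * (MvPolynomial.eval (a • P + b • Q + c • R) (lin P Q) *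
      (MvPolynomial.eval (a • P + b • Q + c • R) (lin Q R) *
      MvPolynomial.eval (a • P + b • Q + c • R) (lin R P))) =
      (area P Q R) ^ 4 * (a * b * c) := by
    have e1 : MvPolynomial.eval (a • P + b • Q + c • R) (lin P Q) = c * area P Q R := by
      rw [lin_eval, ha1]; simp [area]; ring
    have e2 : MvPolynomial.eval (a • P + b • Q + c • R) (lin Q R) = a * area P Q R := by
      rw [lin_eval, ha1]; simp [area]; ring
    have e3 : MvPolynomial.eval (a • P + b • Q + c • R) (lin R P) = b * area P Q R := by
      rw [lin_eval, ha1]; simp [area]; ring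
    rw [e1, e2, e3]; ring
  rw [this]
  positivity

theorem zero_of_open (f : MvPolynomial (Fin 2) ℝ) (U : Set (Fin 2 → ℝ)) (hU : IsOpen U)
    (hne : U.Nonempty) (h : ∀ x ∈ U, MvPolynomial.eval x f = 0) : f = 0 := by
  obtain ⟨x, hx⟩ := hne
  obtain ⟨ε, hε, hb⟩ := Metric.isOpen_iff.1 hU x hx
  refine MvPolynomial.funext_set (fun i => Metric.ball (x i) ε) (fun i => ?_) (fun y hy => ?_)
  · rw [Real.ball_eq_Ioo]; exact Set.Ioo_infinite (by linarith)
  · rw [map_zero]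
    apply h
    apply hb
    rw [ball_pi _ hε]
    exact hy

/-- Unisolvence of the new even-degree Crouzeix–Raviart degrees of freedom. -/
theorem CR_even_unisolvence (p : ℕ) (hp_pos : 0 < p) (hp_even : Even p)
    (A : Fin 3 → (Fin 2 → ℝ)) (hA : AffineIndependent ℝ A)
    (v : MvPolynomial (Fin 2) ℝ) (hv : v.totalDegree ≤ p)
    (hedge : ∀ i j : Fin 3, i ≠ j → ∀ k : ℕ, (k ≤ p - 2 ∨ k = p) →
      ∫ t in (0:ℝ)..1,
        MvPolynomial.eval (edgeParam A i j t) v * (legendre k).eval (2 * t - 1) = 0)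
    (hbulk : ∀ m : MvPolynomial (Fin 2) ℝ, (m.totalDegree : ℤ) ≤ (p : ℤ) - 3 →
      ∫ x in convexHull ℝ ({A 0, A 1, A 2} : Set (Fin 2 → ℝ)),
        MvPolynomial.eval x v * MvPolynomial.eval x m ∂volume = 0) :
    v = 0 := by
  have hD := area_ne A hA
  have hp2 : 2 ≤ p := by rcases hp_even with ⟨m, hm⟩; omega
  have hE : ∀ i j, i ≠ j → ∀ k : ℕ, (k ≤ p - 2 ∨ k = p) →
      ∫ t in (0:ℝ)..1, (restr (A i) (A j) v).eval t * (legendre k).eval (2 * t - 1) = 0 := by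
    intro i j hij k hk
    have := hedge i j hij k hk
    simpa only [restr_eval, edgeParam] using this
  have hvert : ∀ i j, i ≠ j → MvPolynomial.eval (A j) v = - MvPolynomial.eval (A i) v := by
    intro i j hij
    have := edge_antisymm p hp_even hp_pos (restr (A i) (A j) v) (restr_natDegree _ _ _ _ hv)
      (hE i j hij)
    simpa [restr_eval] using this
  have h01 := hvert 0 1 (by decide)
  have h12 := hvert 1 2 (by decide)
  have h20 := hvert 2 0 (by decide)
  have hv0 : ∀ i, MvPolynomial.eval (A i) v = 0 := by
    intro i; fin_cases i <;> simp <;> linarith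
  have hz : ∀ i j, i ≠ j → restr (A i) (A j) v = 0 := by
    intro i j hij
    apply edge_zero p hp2 _ (restr_natDegree _ _ _ _ hv) (fun k hk => hE i j hij k (Or.inl hk))
    · simp [restr_eval, hv0]
    · simp [restr_eval, hv0]
  obtain ⟨w, hw⟩ := factor (A 0) (A 1) (A 2) hD v (hz 0 1 (by decide)) (hz 1 2 (by decide))
    (hz 2 0 (by decide))
  by_contra hvne
  have hwne : w ≠ 0 := by rintro rfl; simp at hw; exact hvne hw
  have hQ : area (A 1) (A 2) (A 0) ≠ 0 := by
    have : area (A 1) (A 2) (A 0) = area (A 0) (A 1) (A 2) := by unfold area; ring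
    rwa [this]
  have hR : area (A 2) (A 0) (A 1) ≠ 0 := by
    have : area (A 2) (A 0) (A 1) = area (A 0) (A 1) (A 2) := by unfold area; ring
    rwa [this]
  obtain ⟨l1, d1⟩ := lin_degree _ _ _ hD
  obtain ⟨l2, d2⟩ := lin_degree _ _ _ hQ
  obtain ⟨l3, d3⟩ := lin_degree _ _ _ hR
  have hdeg : w.totalDegree + 3 ≤ p := by
    rw [hw, MvPolynomial.totalDegree_mul_of_isDomain l1 (mul_ne_zero l2 (mul_ne_zero l3 hwne)),
      MvPolynomial.totalDegree_mul_of_isDomain l2 (mul_ne_zero l3 hwne),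
      MvPolynomial.totalDegree_mul_of_isDomain l3 hwne] at hv
    omega
  set D := area (A 0) (A 1) (A 2) with hDdef
  set K := convexHull ℝ ({A 0, A 1, A 2} : Set (Fin 2 → ℝ)) with hK
  have hint := hbulk (MvPolynomial.C D * w) (by
    have : (MvPolynomial.C D * w).totalDegree ≤ w.totalDegree := by
      refine (MvPolynomial.totalDegree_mul _ _).trans ?_
      simp
    omega)
  have hKc : IsCompact K := (by simp : ({A 0, A 1, A 2} : Set (Fin 2 → ℝ)).Finite).isCompact_convexHull ℝ
  have hcont : Continuous (fun x => MvPolynomial.eval x v *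
      MvPolynomial.eval x (MvPolynomial.C D * w)) :=
    (MvPolynomial.continuous_eval v).mul (MvPolynomial.continuous_eval _)
  have hnn : ∀ x ∈ K, 0 ≤ MvPolynomial.eval x v * MvPolynomial.eval x (MvPolynomial.C D * w) := by
    intro x hx
    have h1 := bubble_nonneg _ _ _ x hx
    have h2 := mul_nonneg h1 (mul_self_nonneg (MvPolynomial.eval x w))
    rw [hw]
    simp only [map_mul, MvPolynomial.eval_C]
    refine h2.trans_eq ?_
    rw [← hDdef]
    ring
  rw [setIntegral_eq_zero_iff_of_nonneg_ae
    ((ae_restrict_iff' hKc.measurableSet).2 (Filter.Eventually.of_forall hnn))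
    (hcont.continuousOn.integrableOn_compact hKc)] at hint
  have hae := ae_restrict_of_ae_restrict_of_subset (interior_subset (s := K)) hint
  have hEq := Measure.eqOn_open_of_ae_eq hae isOpen_interior hcont.continuousOn
    continuous_const.continuousOn
  have hne : (interior K).Nonempty := by
    rw [hK, interior_convexHull_nonempty_iff_affineSpan_eq_top]
    have h3 : ({A 0, A 1, A 2} : Set (Fin 2 → ℝ)) = Set.range A := by
      ext x; simp [Fin.exists_fin_succ, eq_comm]
    rw [h3, hA.affineSpan_eq_top_iff_card_eq_finrank_add_one]
    simp
  have hfin := zero_of_open (v * (MvPolynomial.C D * w)) _ isOpen_interior hne (fun x hx => by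
    rw [map_mul]; exact hEq hx)
  rcases mul_eq_zero.1 hfin with h | h
  · exact hvne h
  · rcases mul_eq_zero.1 h with h | h
    · exact hD (by simpa using h)
    · exact hwne h
end
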